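/- Assume η ∈ P(b,ε) and ε ≥ 0 elementwise. Then strong duality holds for the maximum-entropy program: inf_{z ∈ P(b,ε)} z·log z = − sup_{σ, σ' ∈ ℝ^m, σ ≥ 0, σ' ≥ 0} [ (σ' − σ)·b − (σ' + σ)·ε − Σ_{i=1}^n log( Σ_{ℓ=1}^k exp(a^{(σ'−σ)}_{iℓ}) ) ]·(−1), i.e. the value V := inf_{z ∈ P(b,ε)} z·log z equals sup_{σ,σ' ≥ 0} [ (σ'−σ)·b − (σ'+σ)·ε − Σ_i log( Σ_ℓ exp(a^{(σ'−σ)}_{iℓ}) ) ]. -/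

import Mathlib

open Finset

attribute [local instance] Classical.propDecidable

noncomputable section

/-- The simplex `Δ_k^n`: rows are probability distributions over `Fin k`. -/
def Simplex (n k : ℕ) : Set (Fin n → Fin k → ℝ) :=
  {z | (∀ i ℓ, 0 ≤ z i ℓ) ∧ ∀ i, ∑ ℓ, z i ℓ = 1}

/-- Number of points where rule `j` does not abstain. -/
def nRule {n k p : ℕ} (h : Fin p → Fin n → Option (Fin k)) (j : Fin p) : ℕ :=
  (Finset.univ.filter (fun i => h j i ≠ none)).card

/-- The constraint matrix `A`, with `m = p + k` rows indexed by `Fin p ⊕ Fin k`. -/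
def Amat {n k p : ℕ} (h : Fin p → Fin n → Option (Fin k)) :
    Fin p ⊕ Fin k → Fin n → Fin k → ℝ
  | Sum.inl j => fun i ℓ => if h j i = some ℓ then 1 / (nRule h j : ℝ) else 0
  | Sum.inr ℓ' => fun i ℓ => if ℓ = ℓ' then 1 / (n : ℝ) else 0

/-- `(A z)_j`. -/
def applyA {n k p : ℕ} (h : Fin p → Fin n → Option (Fin k))
    (z : Fin n → Fin k → ℝ) (j : Fin p ⊕ Fin k) : ℝ :=
  ∑ i, ∑ ℓ, Amat h j i ℓ * z i ℓ

/-- The polytope `P(b, ε)`. -/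
def Polytope {n k p : ℕ} (h : Fin p → Fin n → Option (Fin k))
    (b ε : Fin p ⊕ Fin k → ℝ) : Set (Fin n → Fin k → ℝ) :=
  {z | z ∈ Simplex n k ∧ ∀ j, b j - ε j ≤ applyA h z j ∧ applyA h z j ≤ b j + ε j}

/-- Extended-real logarithm, with `elog 0 = ⊥ = -∞`. -/
def elog (x : ℝ) : EReal := if x = 0 then ⊥ else ((Real.log x : ℝ) : EReal)

/-- `z · log g`, valued in `[-∞, 0]` with the convention `0 · log 0 = 0`. -/
def dotlog {n k : ℕ} (z g : Fin n → Fin k → ℝ) : EReal :=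
  ∑ i, ∑ ℓ, (z i ℓ : EReal) * elog (g i ℓ)

/-- `a^{(θ)}_{iℓ} = Σ_j θ_j · A j i ℓ`. -/
def avec {n k p : ℕ} (h : Fin p → Fin n → Option (Fin k))
    (θ : Fin p ⊕ Fin k → ℝ) (i : Fin n) (ℓ : Fin k) : ℝ :=
  ∑ j, θ j * Amat h j i ℓ

/-- The exponential-family (softmax) prediction `g^{(θ)}`. -/
def gexp {n k p : ℕ} (h : Fin p → Fin n → Option (Fin k))
    (θ : Fin p ⊕ Fin k → ℝ) (i : Fin n) (ℓ : Fin k) : ℝ :=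
  Real.exp (avec h θ i ℓ) / ∑ ℓ', Real.exp (avec h θ i ℓ')

/-- The BF dual objective `(σ'−σ)·b − (σ'+σ)·ε − Σ_i log(Σ_ℓ exp(a^{(σ'−σ)}_{iℓ}))`. -/
def dualObj {n k p : ℕ} (h : Fin p → Fin n → Option (Fin k))
    (b ε σ σ' : Fin p ⊕ Fin k → ℝ) : ℝ :=
  (∑ j, (σ' j - σ j) * b j) - (∑ j, (σ' j + σ j) * ε j)
    - ∑ i, Real.log (∑ ℓ, Real.exp (avec h (fun j => σ' j - σ j) i ℓ))

/-- KL summand `a·log(a/c)`, with `0·log(0/c) = 0` and `a·log(a/0) = ⊤` for `a ≠ 0`. -/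
def klTerm (a c : ℝ) : EReal :=
  if a = 0 then 0 else if c = 0 then ⊤ else ((a * Real.log (a / c) : ℝ) : EReal)

/-- `d(μ, ν)`, the summed KL divergences, valued in `[0, +∞]`. -/
def dKL {n k : ℕ} (μ ν : Fin n → Fin k → ℝ) : EReal :=
  ∑ i, ∑ ℓ, klTerm (μ i ℓ) (ν i ℓ)

/-- Unnormalized one-coin Dawid–Skene score `N_{iℓ}`. -/
def Nds {n k p : ℕ} (h : Fin p → Fin n → Option (Fin k))
    (w : Fin k → ℝ) (β : Fin p → ℝ) (i : Fin n) (ℓ : Fin k) : ℝ :=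
  w ℓ * (∏ j ∈ Finset.univ.filter (fun j => h j i = some ℓ), β j)
    * ∏ j ∈ Finset.univ.filter (fun j => ∃ ℓ' ≠ ℓ, h j i = some ℓ'),
        (1 - β j) / ((k : ℝ) - 1)

/-- The one-coin Dawid–Skene prediction `g^{ds}(w, β)`. -/
def gds {n k p : ℕ} (h : Fin p → Fin n → Option (Fin k))
    (w : Fin k → ℝ) (β : Fin p → ℝ) (i : Fin n) (ℓ : Fin k) : ℝ :=
  Nds h w β i ℓ / ∑ ℓ', Nds h w β i ℓ'

/-- The real-valued negative entropy `z · log z`. -/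
def negEntropy {n k : ℕ} (z : Fin n → Fin k → ℝ) : ℝ :=
  ∑ i, ∑ ℓ, z i ℓ * Real.log (z i ℓ)

lemma EReal.coe_finset_sum {ι : Type*} (s : Finset ι) (f : ι → ℝ) :
    ((∑ i ∈ s, f i : ℝ) : EReal) = ∑ i ∈ s, (f i : EReal) :=
  map_sum (⟨⟨Real.toEReal, EReal.coe_zero⟩, EReal.coe_add⟩ : ℝ →+ EReal) f s

lemma coe_mul_elog_self (x : ℝ) : (x : EReal) * elog x = ((x * Real.log x : ℝ) : EReal) := by
  unfold elog
  split_ifs with hx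
  · simp [hx]
  · rw [EReal.coe_mul]

lemma dotlog_self {n k : ℕ} (z : Fin n → Fin k → ℝ) :
    dotlog z z = (negEntropy z : EReal) := by
  simp only [dotlog, negEntropy, EReal.coe_finset_sum, coe_mul_elog_self]

lemma continuous_negEntropy {n k : ℕ} :
    Continuous (negEntropy : (Fin n → Fin k → ℝ) → ℝ) := by
  unfold negEntropy
  refine continuous_finsetSum _ fun i _ => continuous_finsetSum _ fun ℓ _ => ?_
  exact Real.continuous_mul_log.comp (by fun_prop)

lemma convex_simplex (n k : ℕ) : Convex ℝ (Simplex n k) := by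
  rintro x ⟨hx0, hx1⟩ y ⟨hy0, hy1⟩ α β hα hβ hαβ
  refine ⟨fun i ℓ => ?_, fun i => ?_⟩
  · have := hx0 i ℓ
    have := hy0 i ℓ
    simp only [Pi.add_apply, Pi.smul_apply, smul_eq_mul]
    positivity
  · simp only [Pi.add_apply, Pi.smul_apply, smul_eq_mul, sum_add_distrib, ← mul_sum, hx1, hy1,
      mul_one, hαβ]

lemma le_one_of_mem_simplex {n k : ℕ} {z : Fin n → Fin k → ℝ} (hz : z ∈ Simplex n k)
    (i : Fin n) (ℓ : Fin k) : z i ℓ ≤ 1 :=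
  hz.2 i ▸ single_le_sum (f := z i) (fun ℓ' _ => hz.1 i ℓ') (mem_univ ℓ)

lemma isCompact_simplex (n k : ℕ) : IsCompact (Simplex n k) := by
  have hclosed : IsClosed (Simplex n k) := by
    have : Simplex n k = (⋂ i, ⋂ ℓ, {z | 0 ≤ z i ℓ}) ∩ ⋂ i, {z | ∑ ℓ, z i ℓ = 1} := by
      ext z
      simp [Simplex]
    rw [this]
    refine (isClosed_iInter fun i => isClosed_iInter fun ℓ => ?_).inter (isClosed_iInter fun i => ?_)
    · exact isClosed_le continuous_const (by fun_prop)
    · exact isClosed_eq (by fun_prop) continuous_const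
  refine (isCompact_Icc (a := (0 : Fin n → Fin k → ℝ)) (b := 1)).of_isClosed_subset hclosed ?_
  exact fun z hz => ⟨fun i ℓ => hz.1 i ℓ, fun i ℓ => le_one_of_mem_simplex hz i ℓ⟩

lemma convexOn_negEntropy (n k : ℕ) : ConvexOn ℝ (Simplex n k) negEntropy := by
  refine ⟨convex_simplex n k, fun x hx y hy α β hα hβ hαβ => ?_⟩
  simp only [negEntropy, smul_eq_mul, mul_sum, ← sum_add_distrib]
  exact sum_le_sum fun i _ => sum_le_sum fun ℓ _ =>
    Real.convexOn_mul_log.2 (hx.1 i ℓ) (hy.1 i ℓ) hα hβ hαβ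

lemma negEntropy_nonpos {n k : ℕ} {z : Fin n → Fin k → ℝ} (hz : z ∈ Simplex n k) :
    negEntropy z ≤ 0 :=
  sum_nonpos fun i _ => sum_nonpos fun ℓ _ =>
    Real.mul_log_nonpos (hz.1 i ℓ) (le_one_of_mem_simplex hz i ℓ)

/-- The Gibbs variational inequality. -/
lemma sum_mul_sub_log_sum_exp_le {ι : Type*} [Fintype ι] [Nonempty ι] (a q : ι → ℝ)
    (hq0 : ∀ i, 0 ≤ q i) (hq1 : ∑ i, q i = 1) :
    ∑ i, a i * q i - Real.log (∑ i, Real.exp (a i)) ≤ ∑ i, q i * Real.log (q i) := by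
  set Z := ∑ i, Real.exp (a i) with hZ
  have hZpos : 0 < Z := sum_pos (fun i _ => Real.exp_pos _) univ_nonempty
  have key : ∀ i, a i * q i - q i * Real.log Z - q i * Real.log (q i)
      ≤ Real.exp (a i) / Z - q i := by
    intro i
    rcases (hq0 i).eq_or_lt with h0 | hpos
    · rw [← h0]
      simp only [mul_zero, zero_mul, sub_zero]
      positivity
    · have hlog := Real.log_le_sub_one_of_pos (x := Real.exp (a i) / Z / q i) (by positivity)
      rw [Real.log_div (by positivity) hpos.ne', Real.log_div (by positivity) hZpos.ne',
        Real.log_exp] at hlog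
      have := mul_le_mul_of_nonneg_left hlog hpos.le
      have heq : q i * (Real.exp (a i) / Z / q i - 1) = Real.exp (a i) / Z - q i := by
        field_simp
      linarith
  have hsum := sum_le_sum fun i (_ : i ∈ univ) => key i
  simp only [sum_sub_distrib, ← sum_mul, ← sum_div, hq1, ← hZ, div_self hZpos.ne'] at hsum
  linarith

lemma continuousLinearMap_pi_prod_apply {ι : Type*} [Fintype ι] [DecidableEq ι]
    (F : (ι → ℝ) × ℝ →L[ℝ] ℝ) (u : ι → ℝ) (t : ℝ) :
    F (u, t) = ∑ j, F (Pi.single j 1, 0) * u j + F (0, 1) * t := by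
  have hu : F (u, 0) = ∑ j, F (Pi.single j 1, 0) * u j := by
    have := LinearMap.pi_apply_eq_sum_univ
      (F.toLinearMap ∘ₗ LinearMap.inl ℝ (ι → ℝ) ℝ) u
    simp only [LinearMap.comp_apply, LinearMap.inl_apply, smul_eq_mul] at this
    refine this.trans (sum_congr rfl fun j _ => ?_)
    have hsingle : (fun i => if j = i then (1 : ℝ) else 0) = Pi.single j 1 := by
      ext i
      simp [Pi.single_apply, eq_comm]
    rw [hsingle, mul_comm]
    rfl
  have ht : F (0, t) = F (0, 1) * t := by
    have : ((0 : ι → ℝ), t) = t • ((0 : ι → ℝ), (1 : ℝ)) := by simp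
    rw [this, map_smul, smul_eq_mul, mul_comm]
  rw [← hu, ← ht, ← map_add]
  simp

section Duality

variable {n k p : ℕ} (h : Fin p → Fin n → Option (Fin k))

lemma sum_mul_applyA (θ : Fin p ⊕ Fin k → ℝ) (z : Fin n → Fin k → ℝ) :
    ∑ j, θ j * applyA h z j = ∑ i, ∑ ℓ, avec h θ i ℓ * z i ℓ := by
  simp only [applyA, avec, mul_sum, sum_mul]
  rw [sum_comm]
  refine sum_congr rfl fun i _ => ?_
  rw [sum_comm]
  exact sum_congr rfl fun ℓ _ => sum_congr rfl fun j _ => by ring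

lemma applyA_combo (x y : Fin n → Fin k → ℝ) (α β : ℝ) :
    applyA h (α • x + β • y) = α • applyA h x + β • applyA h y := by
  ext j
  simp only [applyA, Pi.add_apply, Pi.smul_apply, smul_eq_mul, mul_sum, ← sum_add_distrib]
  exact sum_congr rfl fun i _ => sum_congr rfl fun ℓ _ => by ring

lemma continuous_applyA : Continuous (applyA h) := by
  unfold applyA
  fun_prop

lemma gexp_mem_simplex (hk : 0 < k) (θ : Fin p ⊕ Fin k → ℝ) : gexp h θ ∈ Simplex n k := by
  have : Nonempty (Fin k) := ⟨⟨0, hk⟩⟩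
  have hZ : ∀ i, 0 < ∑ ℓ, Real.exp (avec h θ i ℓ) := fun i =>
    sum_pos (fun ℓ _ => Real.exp_pos _) univ_nonempty
  refine ⟨fun i ℓ => div_nonneg (Real.exp_pos _).le (hZ i).le, fun i => ?_⟩
  simp only [gexp, ← sum_div]
  exact div_self (hZ i).ne'

lemma negEntropy_gexp (hk : 0 < k) (θ : Fin p ⊕ Fin k → ℝ) :
    negEntropy (gexp h θ) = ∑ j, θ j * applyA h (gexp h θ) j
      - ∑ i, Real.log (∑ ℓ, Real.exp (avec h θ i ℓ)) := by
  have : Nonempty (Fin k) := ⟨⟨0, hk⟩⟩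
  rw [sum_mul_applyA, negEntropy, ← sum_sub_distrib]
  refine sum_congr rfl fun i _ => ?_
  have hZ : 0 < ∑ ℓ, Real.exp (avec h θ i ℓ) :=
    sum_pos (fun ℓ _ => Real.exp_pos _) univ_nonempty
  have hlog : ∀ ℓ, gexp h θ i ℓ * Real.log (gexp h θ i ℓ) = avec h θ i ℓ * gexp h θ i ℓ
      - gexp h θ i ℓ * Real.log (∑ ℓ, Real.exp (avec h θ i ℓ)) := by
    intro ℓ
    have : Real.log (gexp h θ i ℓ) = avec h θ i ℓ - Real.log (∑ ℓ, Real.exp (avec h θ i ℓ)) := by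
      rw [gexp, Real.log_div (Real.exp_pos _).ne' hZ.ne', Real.log_exp]
    rw [this]
    ring
  simp only [hlog, sum_sub_distrib, ← sum_mul, (gexp_mem_simplex h hk θ).2 i, one_mul]

lemma dualObj_le_negEntropy (hk : 0 < k) {b ε σ σ' : Fin p ⊕ Fin k → ℝ} (hσ : ∀ j, 0 ≤ σ j)
    (hσ' : ∀ j, 0 ≤ σ' j) {z : Fin n → Fin k → ℝ} (hz : z ∈ Polytope h b ε) :
    dualObj h b ε σ σ' ≤ negEntropy z := by
  have : Nonempty (Fin k) := ⟨⟨0, hk⟩⟩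
  have hlin : ∑ j, (σ' j - σ j) * b j - ∑ j, (σ' j + σ j) * ε j
      ≤ ∑ j, (σ' j - σ j) * applyA h z j := by
    rw [← sum_sub_distrib]
    refine sum_le_sum fun j _ => ?_
    have h1 := mul_le_mul_of_nonneg_left (hz.2 j).1 (hσ' j)
    have h2 := mul_le_mul_of_nonneg_left (hz.2 j).2 (hσ j)
    linarith
  rw [sum_mul_applyA h (fun j => σ' j - σ j)] at hlin
  have hgibbs := sum_le_sum fun i (_ : i ∈ univ) =>
    sum_mul_sub_log_sum_exp_le (avec h (fun j => σ' j - σ j) i) (z i) (hz.1.1 i) (hz.1.2 i)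
  rw [sum_sub_distrib] at hgibbs
  simp only [dualObj, negEntropy]
  linarith

/-- The attainable pairs of constraint value and truncated objective bound. -/
def attainable : Set ((Fin p ⊕ Fin k → ℝ) × ℝ) :=
  (fun x : (Fin n → Fin k → ℝ) × ℝ => (applyA h x.1, x.2)) ''
    {x | x.1 ∈ Simplex n k ∧ negEntropy x.1 ≤ x.2 ∧ x.2 ≤ 0}

lemma convex_attainable : Convex ℝ (attainable h) := by
  rintro _ ⟨⟨x, s⟩, ⟨hx, hxs, hs⟩, rfl⟩ _ ⟨⟨y, t⟩, ⟨hy, hyt, ht⟩, rfl⟩ α β hα hβ hαβ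
  refine ⟨(α • x + β • y, α * s + β * t), ⟨convex_simplex n k hx hy hα hβ hαβ, ?_, ?_⟩, ?_⟩
  · refine ((convexOn_negEntropy n k).2 hx hy hα hβ hαβ).trans ?_
    simp only [smul_eq_mul] at *
    gcongr
  · have := mul_nonpos_of_nonneg_of_nonpos hα hs
    have := mul_nonpos_of_nonneg_of_nonpos hβ ht
    simp only at *
    linarith
  · simp [applyA_combo]

lemma isCompact_attainable : IsCompact (attainable h) := by
  refine IsCompact.image ?_ (((continuous_applyA h).comp continuous_fst).prodMk continuous_snd)
  obtain ⟨c, hc⟩ := ((isCompact_simplex n k).image continuous_negEntropy).bddBelow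
  refine ((isCompact_simplex n k).prod (isCompact_Icc (a := c) (b := 0))).of_isClosed_subset ?_ ?_
  · refine ((isCompact_simplex n k).isClosed.preimage continuous_fst).inter
      (IsClosed.inter (isClosed_le ?_ continuous_snd) (isClosed_le continuous_snd continuous_const))
    exact continuous_negEntropy.comp continuous_fst
  · rintro ⟨z, t⟩ ⟨hz, hzt, ht⟩
    exact ⟨hz, (hc ⟨z, hz, rfl⟩).trans hzt, ht⟩

lemma exists_multiplier {b ε : Fin p ⊕ Fin k → ℝ} {c : ℝ} (hne : (Polytope h b ε).Nonempty)
    (hc : ∀ z ∈ Polytope h b ε, c < negEntropy z) :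
    ∃ θ : Fin p ⊕ Fin k → ℝ, ∀ z ∈ Simplex n k, ∀ u ∈ Set.Icc (b - ε) (b + ε),
      c + ∑ j, θ j * applyA h z j < negEntropy z + ∑ j, θ j * u j := by
  have hdisj : Disjoint (Set.Icc (b - ε) (b + ε) ×ˢ {c}) (attainable h) := by
    rw [Set.disjoint_left]
    rintro _ ⟨⟨hl, hu⟩, hcc⟩ ⟨⟨z, t⟩, ⟨hz, hzt, -⟩, rfl⟩
    have := hc z ⟨hz, fun j => ⟨hl j, hu j⟩⟩
    simp only [Set.mem_singleton_iff] at hcc hzt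
    linarith
  obtain ⟨F, r, s, hFr, hrs, hsF⟩ := geometric_hahn_banach_compact_closed
    ((convex_Icc _ _).prod (convex_singleton c)) (isCompact_Icc.prod isCompact_singleton)
    (convex_attainable h) (isCompact_attainable h).isClosed hdisj
  have hsep : ∀ z ∈ Simplex n k, ∀ u ∈ Set.Icc (b - ε) (b + ε),
      ∑ j, F (Pi.single j 1, 0) * u j + F (0, 1) * c
        < ∑ j, F (Pi.single j 1, 0) * applyA h z j + F (0, 1) * negEntropy z := by
    intro z hz u hu
    have h1 := hFr (u, c) ⟨hu, rfl⟩
    have h2 := hsF _ ⟨(z, negEntropy z), ⟨hz, le_rfl, negEntropy_nonpos hz⟩, rfl⟩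
    rw [continuousLinearMap_pi_prod_apply] at h1 h2
    exact h1.trans (hrs.trans h2)
  have hτ : 0 < F (0, 1) := by
    obtain ⟨z, hz⟩ := hne
    have h1 := hsep z hz.1 (applyA h z) ⟨fun j => (hz.2 j).1, fun j => (hz.2 j).2⟩
    have h2 := hc z hz
    exact pos_of_mul_pos_left (b := negEntropy z - c) (by linarith) (by linarith)
  refine ⟨fun j => -(F (Pi.single j 1, 0) / F (0, 1)), fun z hz u hu => ?_⟩
  have hscale : ∀ v : Fin p ⊕ Fin k → ℝ, ∑ j, -(F (Pi.single j 1, 0) / F (0, 1)) * v j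
      = -(∑ j, F (Pi.single j 1, 0) * v j) / F (0, 1) := by
    intro v
    rw [← sum_neg_distrib, sum_div]
    exact sum_congr rfl fun j _ => by ring
  have h1 := hsep z hz u hu
  rw [hscale, hscale]
  rw [← mul_lt_mul_iff_right₀ hτ, mul_add, mul_add, mul_div_cancel₀ _ hτ.ne',
    mul_div_cancel₀ _ hτ.ne']
  linarith

lemma exists_lt_dualObj (hk : 0 < k) {b ε : Fin p ⊕ Fin k → ℝ} (hε : ∀ j, 0 ≤ ε j) {c : ℝ}
    (hne : (Polytope h b ε).Nonempty) (hc : ∀ z ∈ Polytope h b ε, c < negEntropy z) :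
    ∃ σ σ' : Fin p ⊕ Fin k → ℝ, (∀ j, 0 ≤ σ j) ∧ (∀ j, 0 ≤ σ' j) ∧
      c < dualObj h b ε σ σ' := by
  obtain ⟨θ, hθ⟩ := exists_multiplier h hne hc
  have hu : (fun j => b j - SignType.sign (θ j) * ε j) ∈ Set.Icc (b - ε) (b + ε) := by
    constructor <;> intro j <;> have := hε j <;>
      rcases lt_trichotomy (θ j) 0 with hj | hj | hj <;> simp [hj, sign_neg, sign_pos] <;> linarith
  refine ⟨fun j => (θ j)⁻, fun j => (θ j)⁺, fun j => negPart_nonneg _, fun j => posPart_nonneg _, ?_⟩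
  have hlt := hθ _ (gexp_mem_simplex h hk θ) _ hu
  rw [negEntropy_gexp h hk] at hlt
  have hval : ∑ j, θ j * (b j - SignType.sign (θ j) * ε j)
      = ∑ j, θ j * b j - ∑ j, |θ j| * ε j := by
    rw [← sum_sub_distrib]
    exact sum_congr rfl fun j _ => by rw [← self_mul_sign]; ring
  rw [hval] at hlt
  simp only [dualObj, posPart_sub_negPart, posPart_add_negPart]
  linarith

end Duality

/-- strong duality for the maximum-entropy program. -/
theorem stmt1 {n k p : ℕ} (hn : 0 < n) (hk : 2 ≤ k) (hp : 0 < p)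
    (h : Fin p → Fin n → Option (Fin k)) (hnj : ∀ j, 0 < nRule h j)
    (η : Fin n → Fin k → ℝ) (b ε : Fin p ⊕ Fin k → ℝ)
    (hε : ∀ j, 0 ≤ ε j) (hmem : η ∈ Polytope h b ε) :
    (⨅ z ∈ Polytope h b ε, dotlog z z)
      = ⨆ (σ : Fin p ⊕ Fin k → ℝ) (_ : ∀ j, 0 ≤ σ j)
          (σ' : Fin p ⊕ Fin k → ℝ) (_ : ∀ j, 0 ≤ σ' j),
          ((dualObj h b ε σ σ' : ℝ) : EReal) := by
  have hk0 : 0 < k := by omega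
  refine le_antisymm (le_of_not_gt fun hlt => ?_) ?_
  · obtain ⟨c, hc1, hc2⟩ := EReal.lt_iff_exists_real_btwn.1 hlt
    obtain ⟨σ, σ', hσ, hσ', hobj⟩ := exists_lt_dualObj h hk0 hε ⟨η, hmem⟩ (c := c) fun z hz => by
      rw [← EReal.coe_lt_coe_iff, ← dotlog_self]
      exact hc2.trans_le (iInf₂_le z hz)
    refine (hc1.trans (EReal.coe_lt_coe_iff.2 hobj)).not_ge ?_
    exact le_iSup₂_of_le σ hσ (le_iSup₂_of_le σ' hσ' le_rfl)
  · refine le_iInf₂ fun z hz => iSup₂_le fun σ hσ => iSup₂_le fun σ' hσ' => ?_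
    rw [dotlog_self, EReal.coe_le_coe_iff]
    exact dualObj_le_negEntropy h hk0 hσ hσ' hz
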